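/- Let n > p ≥ 1, let R be an n×n real symmetric positive definite matrix, let X be an n×p real matrix of full column rank, and let y ∈ ℝ^n be such that y does not lie in the column space of X. Let ν > 0 and let a be a real number with 1 − (n−p)/2 < a < ν/2 + 1. Define the multivariate Student-t density f_{ν,Σ}(z) = Γ((ν+n)/2) ν^{ν/2} / (Γ(ν/2) π^{n/2} (det Σ)^{1/2}) · (ν + zᵀΣ⁻¹z)^{-(ν+n)/2}, β̂ = (XᵀR⁻¹X)⁻¹XᵀR⁻¹y, and S̃ = (y − Xβ̂)ᵀR⁻¹(y − Xβ̂). Then ∫_{ℝ^p} ∫_0^∞ f_{ν,σ²R}(y − Xβ) (σ²)^{-a} dσ² dβ = [Γ((n−p)/2 + a − 1) / π^{(n−p)/2}] · A(ν) · (det R)^{-1/2} (det(XᵀR⁻¹X))^{-1/2} · S̃^{-((n−p)/2 + a − 1)}, where A(ν) = ν^{a−1} Γ(ν/2 − a + 1)/Γ(ν/2). -/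

import Mathlib

open MeasureTheory Matrix Real

lemma beta_real (b c : ℝ) (hb : 0 < b) (hc : 0 < c) :
    ∫ u in Set.Ioo (0:ℝ) 1, u ^ (b - 1) * (1 - u) ^ (c - 1) =
      Real.Gamma b * Real.Gamma c / Real.Gamma (b + c) := by
  have h := ProbabilityTheory.beta_eq_betaIntegralReal b c hb hc
  rw [ProbabilityTheory.beta] at h
  rw [h, Complex.betaIntegral, intervalIntegral.integral_of_le zero_le_one,
    ← integral_Ioc_eq_integral_Ioo]
  have : ∫ x in Set.Ioc (0:ℝ) 1, (x:ℂ) ^ ((b:ℂ) - 1) * (1 - (x:ℂ)) ^ ((c:ℂ) - 1) =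
      ∫ x in Set.Ioc (0:ℝ) 1, ((x ^ (b - 1) * (1 - x) ^ (c - 1) : ℝ) : ℂ) := by
    apply setIntegral_congr_fun measurableSet_Ioc
    intro x hx
    simp only
    rw [Complex.ofReal_mul, Complex.ofReal_cpow hx.1.le, Complex.ofReal_cpow (by linarith [hx.2])]
    push_cast
    rfl
  rw [this, integral_complex_ofReal, Complex.ofReal_re]

lemma beta_Ioi (b c ν Q : ℝ) (hb : 0 < b) (hc : 0 < c) (hν : 0 < ν) (hQ : 0 < Q) :
    ∫ s in Set.Ioi (0:ℝ), s ^ (b - 1) * (ν * s + Q) ^ (-(b + c)) =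
      ν ^ (-b) * Q ^ (-c) * (Real.Gamma b * Real.Gamma c / Real.Gamma (b + c)) := by
  have him : (fun u : ℝ => Q / ν * (u / (1 - u))) '' Set.Ioo (0:ℝ) 1 = Set.Ioi 0 := by
    ext s
    simp only [Set.mem_image, Set.mem_Ioo, Set.mem_Ioi]
    constructor
    · rintro ⟨u, ⟨h0, h1⟩, rfl⟩
      have : 0 < 1 - u := by linarith
      positivity
    · intro hs
      refine ⟨ν * s / (ν * s + Q), ⟨by positivity, ?_⟩, ?_⟩
      · rw [div_lt_one (by positivity)]; linarith
      · have : 1 - ν * s / (ν * s + Q) = Q / (ν * s + Q) := by field_simp; ring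
        rw [this]; field_simp
  rw [← him, integral_image_eq_integral_abs_deriv_smul (f' := fun u => Q / ν * (1 / (1 - u) ^ 2))
    measurableSet_Ioo]
  · rw [← beta_real b c hb hc, ← integral_const_mul]
    apply setIntegral_congr_fun measurableSet_Ioo
    rintro u ⟨h0, h1⟩
    have h2 : 0 < 1 - u := by linarith
    simp only [smul_eq_mul]
    rw [abs_of_pos (by positivity)]
    have e : ν * (Q / ν * (u / (1 - u))) + Q = Q / (1 - u) := by field_simp; ring
    rw [e, mul_rpow (by positivity) (by positivity), div_rpow hQ.le hν.le, div_rpow h0.le h2.le,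
      div_rpow hQ.le h2.le]
    have p1 : Q ^ (b - 1) = Q ^ b / Q := by rw [rpow_sub_one hQ.ne']
    have p2 : ν ^ (b - 1) = ν ^ b / ν := by rw [rpow_sub_one hν.ne']
    have p3 : (1 - u) ^ (b - 1) = (1 - u) ^ b / (1 - u) := by rw [rpow_sub_one h2.ne']
    have p4 : (1 - u) ^ (c - 1) = (1 - u) ^ c / (1 - u) := by rw [rpow_sub_one h2.ne']
    rw [p1, p2, p3, p4, rpow_neg hQ.le, rpow_neg h2.le, rpow_neg hν.le, rpow_neg hQ.le,
      rpow_add hQ, rpow_add h2]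
    have := rpow_pos_of_pos hQ b
    have := rpow_pos_of_pos hQ c
    have := rpow_pos_of_pos hν b
    have := rpow_pos_of_pos h2 b
    have := rpow_pos_of_pos h2 c
    field_simp
  · rintro u ⟨h0, h1⟩
    have h2 : 1 - u ≠ 0 := by linarith
    have := (((hasDerivAt_id u).div ((hasDerivAt_id u).const_sub 1) h2).const_mul (Q / ν))
    refine (this.congr_deriv ?_).hasDerivWithinAt
    simp
  · rintro u ⟨h0, h1⟩ v ⟨h3, h4⟩ h
    have h2 : 1 - u ≠ 0 := by linarith
    have h5 : 1 - v ≠ 0 := by linarith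
    simp only at h
    have h6 := mul_left_cancel₀ (by positivity) h
    rw [div_eq_div_iff h2 h5] at h6
    linarith

lemma radial (p : ℕ) (hp : 1 ≤ p) (k S : ℝ) (hk : (p:ℝ) / 2 < k) (hS : 0 < S) :
    ∫ z : Fin p → ℝ, (S + z ⬝ᵥ z) ^ (-k) =
      π ^ ((p:ℝ) / 2) * Real.Gamma (k - p / 2) / Real.Gamma k * S ^ (-(k - p / 2)) := by
  have : Nonempty (Fin p) := ⟨⟨0, hp⟩⟩
  have hp0 : (0:ℝ) < p := by exact_mod_cast hp
  rw [← (PiLp.volume_preserving_ofLp (Fin p)).integral_comp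
    (MeasurableEquiv.toLp 2 (Fin p → ℝ)).symm.measurableEmbedding]
  have e : ∀ x : EuclideanSpace ℝ (Fin p), x.ofLp ⬝ᵥ x.ofLp = ‖x‖ ^ 2 := by
    intro x
    rw [EuclideanSpace.real_norm_sq_eq]
    simp [dotProduct, sq]
  simp_rw [e]
  rw [integral_fun_norm_addHaar volume (fun r => (S + r ^ 2) ^ (-k))]
  have hb : (volume : Measure (EuclideanSpace ℝ (Fin p))).real (Metric.ball 0 1) =
      π ^ ((p:ℝ) / 2) / Real.Gamma (p / 2 + 1) := by
    rw [Measure.real, EuclideanSpace.volume_ball]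
    have := Real.Gamma_pos_of_pos (show (0:ℝ) < p / 2 + 1 by positivity)
    simp only [ENNReal.ofReal_one, one_pow, one_mul, Fintype.card_fin]
    rw [ENNReal.toReal_ofReal (by positivity), Real.sqrt_eq_rpow, ← rpow_natCast, ← rpow_mul pi_pos.le]
    ring_nf
  have hI : ∫ r in Set.Ioi (0:ℝ), r ^ (p - 1) • (S + r ^ 2) ^ (-k) =
      1 / 2 * (S ^ (-(k - p / 2)) * (Real.Gamma (p / 2) * Real.Gamma (k - p / 2) / Real.Gamma k)) := by
    have h := beta_Ioi (p / 2) (k - p / 2) 1 S (by positivity) (by linarith) one_pos hS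
    rw [← integral_comp_rpow_Ioi_of_pos (p := 2) two_pos] at h
    rw [one_rpow, one_mul, add_sub_cancel] at h
    rw [← h, ← integral_const_mul]
    apply setIntegral_congr_fun measurableSet_Ioi
    intro r hr
    have hr : 0 < r := hr
    simp only [smul_eq_mul]
    rw [← rpow_mul hr.le, ← rpow_natCast r (p - 1), Nat.cast_sub hp, one_mul, add_comm S, rpow_two]
    have : r ^ ((p:ℝ) - (1:ℕ)) = r ^ ((2:ℝ) - 1) * r ^ (2 * ((p:ℝ) / 2 - 1)) := by
      rw [← rpow_add hr]; congr 1; push_cast; ring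
    rw [this]; ring
  rw [finrank_euclideanSpace_fin, hb, hI, Real.Gamma_add_one (by positivity)]
  have := Real.Gamma_pos_of_pos (show (0:ℝ) < p / 2 by positivity)
  simp only [nsmul_eq_mul, smul_eq_mul]
  field_simp

lemma gauss_like (p : ℕ) (hp : 1 ≤ p) (k S : ℝ) (hk : (p:ℝ) / 2 < k) (hS : 0 < S)
    (M : Matrix (Fin p) (Fin p) ℝ) (hM : M.PosDef) :
    ∫ z : Fin p → ℝ, (S + z ⬝ᵥ M *ᵥ z) ^ (-k) = M.det ^ (-(1:ℝ) / 2) *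
      (π ^ ((p:ℝ) / 2) * Real.Gamma (k - p / 2) / Real.Gamma k * S ^ (-(k - p / 2))) := by
  obtain ⟨B, hB⟩ : ∃ B : Matrix (Fin p) (Fin p) ℝ, M = Bᵀ * B := by
    open scoped MatrixOrder Matrix.Norms.L2Operator in
    obtain ⟨B, hB⟩ := CStarAlgebra.nonneg_iff_eq_star_mul_self.mp hM.posSemidef.nonneg
    refine ⟨B, ?_⟩
    rw [hB, star_eq_conjTranspose, conjTranspose_eq_transpose_of_trivial]
  have hd : M.det = B.det ^ 2 := by rw [hB, det_mul, det_transpose, sq]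
  have hpos := hM.det_pos
  have hB0 : B.det ≠ 0 := by
    intro h; rw [hd, h] at hpos; simp at hpos
  rw [← radial p hp k S hk hS]
  have e : ∀ z : Fin p → ℝ, z ⬝ᵥ M *ᵥ z = (toLin' B z) ⬝ᵥ (toLin' B z) := by
    intro z
    rw [toLin'_apply, hB, ← mulVec_mulVec, dotProduct_mulVec, vecMul_transpose]
  simp_rw [e]
  have h1 := integral_map (μ := (volume : Measure (Fin p → ℝ))) (φ := toLin' B)
    (f := fun z : Fin p → ℝ => (S + z ⬝ᵥ z) ^ (-k))
    (LinearMap.continuous_of_finiteDimensional _).aemeasurable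
    (by
      apply Measurable.aestronglyMeasurable
      unfold dotProduct
      fun_prop)
  rw [← h1, Real.map_matrix_volume_pi_eq_smul_volume_pi hB0, integral_smul_measure, smul_eq_mul,
    ENNReal.toReal_ofReal (abs_nonneg _)]
  congr 1
  rw [hd, abs_inv, ← sq_abs, ← rpow_two, ← rpow_mul (abs_nonneg _),
    ← rpow_neg_one]
  norm_num

lemma inner_int (n : ℕ) (R : Matrix (Fin n) (Fin n) ℝ) (hR : R.PosDef) (z : Fin n → ℝ)
    (ν a : ℝ) (hν : 0 < ν) (ha0 : 1 - (n:ℝ) / 2 < a) (ha2 : a < ν / 2 + 1)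
    (hQ : 0 < z ⬝ᵥ R⁻¹ *ᵥ z) :
    ∫ σ2 in Set.Ioi (0 : ℝ),
      (Real.Gamma ((ν + n) / 2) * ν ^ (ν / 2) /
        (Real.Gamma (ν / 2) * π ^ ((n : ℝ) / 2) * (σ2 • R).det ^ ((1 : ℝ) / 2)) *
        (ν + z ⬝ᵥ (σ2 • R)⁻¹ *ᵥ z) ^ (-(ν + n) / 2)) *
        σ2 ^ (-a) =
    ν ^ (a - 1) * Real.Gamma (ν / 2 - a + 1) * Real.Gamma ((n:ℝ) / 2 + a - 1) /
      (Real.Gamma (ν / 2) * π ^ ((n : ℝ) / 2)) * R.det ^ (-(1:ℝ) / 2) *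
      (z ⬝ᵥ R⁻¹ *ᵥ z) ^ (-((n:ℝ) / 2 + a - 1)) := by
  set Q := z ⬝ᵥ R⁻¹ *ᵥ z with hQd
  have hdet := hR.det_pos
  have h := beta_Ioi (ν / 2 - a + 1) ((n:ℝ) / 2 + a - 1) ν Q (by linarith) (by linarith) hν hQ
  rw [show ν / 2 - a + 1 + ((n:ℝ) / 2 + a - 1) = (ν + n) / 2 by ring] at h
  have hn0 : (0:ℝ) ≤ n := Nat.cast_nonneg n
  have hG := Real.Gamma_pos_of_pos (show 0 < (ν + n) / 2 by positivity)
  have hG2 := Real.Gamma_pos_of_pos (show 0 < ν / 2 by positivity)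
  have hpi := rpow_pos_of_pos pi_pos ((n:ℝ) / 2)
  trans (Real.Gamma ((ν + n) / 2) * ν ^ (ν / 2) /
        (Real.Gamma (ν / 2) * π ^ ((n : ℝ) / 2)) * R.det ^ (-(1:ℝ) / 2)) *
      ∫ s in Set.Ioi (0:ℝ), s ^ (ν / 2 - a + 1 - 1) * (ν * s + Q) ^ (-((ν + n) / 2))
  · rw [← integral_const_mul]
    apply setIntegral_congr_fun measurableSet_Ioi
    intro s hs
    have hs : 0 < s := hs
    have e1 : z ⬝ᵥ (s • R)⁻¹ *ᵥ z = Q / s := by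
      have : (s • R)⁻¹ = s⁻¹ • R⁻¹ := by
        apply inv_eq_left_inv
        rw [smul_mul_smul_comm, inv_mul_cancel₀ hs.ne', one_smul,
          nonsing_inv_mul _ (isUnit_iff_ne_zero.mpr hdet.ne')]
      rw [this, smul_mulVec, dotProduct_smul, smul_eq_mul, ← hQd, div_eq_inv_mul]
    have e2 : ν + Q / s = (ν * s + Q) / s := by field_simp
    simp only
    rw [e1, e2, det_smul, Fintype.card_fin, mul_rpow (by positivity) hdet.le,
      div_rpow (by positivity) hs.le, neg_div, neg_div, rpow_neg hdet.le, rpow_neg hs.le,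
      ← rpow_natCast, ← rpow_mul hs.le]
    have e3 : s ^ (ν / 2 - a + 1 - 1) =
        s ^ (-a) * s ^ ((ν + n) / 2) / s ^ ((n:ℝ) * (1 / 2)) := by
      rw [← rpow_add hs, ← rpow_sub hs]; congr 1; ring
    rw [e3]
    have := rpow_pos_of_pos hs ((ν + n) / 2)
    have := rpow_pos_of_pos hs ((n:ℝ) * (1 / 2))
    have := rpow_pos_of_pos hdet ((1:ℝ) / 2)
    field_simp
  · rw [h]
    have e4 : ν ^ (a - 1) = ν ^ (ν / 2) * ν ^ (-(ν / 2 - a + 1)) := by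
      rw [← rpow_add hν]; congr 1; ring
    rw [e4]
    field_simp

/-- Proposition 1 of the paper: the marginal posterior of (φ, ν) obtained by
integrating the Student-t likelihood against the improper prior (σ²)^{-a}. -/
theorem stmt7 (n p : ℕ) (hp : 1 ≤ p) (hnp : p < n)
    (R : Matrix (Fin n) (Fin n) ℝ) (hR : R.PosDef)
    (X : Matrix (Fin n) (Fin p) ℝ) (hX : X.rank = p)
    (y : Fin n → ℝ) (hy : ¬ ∃ β : Fin p → ℝ, y = X *ᵥ β)
    (ν a : ℝ) (hν : 0 < ν)
    (ha1 : 1 - ((n : ℝ) - p) / 2 < a) (ha2 : a < ν / 2 + 1) :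
    ∫ β : Fin p → ℝ, ∫ σ2 in Set.Ioi (0 : ℝ),
      (Real.Gamma ((ν + n) / 2) * ν ^ (ν / 2) /
        (Real.Gamma (ν / 2) * π ^ ((n : ℝ) / 2) * (σ2 • R).det ^ ((1 : ℝ) / 2)) *
        (ν + (y - X *ᵥ β) ⬝ᵥ (σ2 • R)⁻¹ *ᵥ (y - X *ᵥ β)) ^ (-(ν + n) / 2)) *
        σ2 ^ (-a) =
      Real.Gamma (((n : ℝ) - p) / 2 + a - 1) / π ^ (((n : ℝ) - p) / 2) *
        (ν ^ (a - 1) * Real.Gamma (ν / 2 - a + 1) / Real.Gamma (ν / 2)) *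
        R.det ^ (-(1 : ℝ) / 2) * (Xᵀ * R⁻¹ * X).det ^ (-(1 : ℝ) / 2) *
        ((y - X *ᵥ (((Xᵀ * R⁻¹ * X)⁻¹ * Xᵀ * R⁻¹) *ᵥ y)) ⬝ᵥ
            R⁻¹ *ᵥ (y - X *ᵥ (((Xᵀ * R⁻¹ * X)⁻¹ * Xᵀ * R⁻¹) *ᵥ y))) ^
          (-(((n : ℝ) - p) / 2 + a - 1)) := by
  have hXinj : Function.Injective X.mulVec := by
    rw [mulVec_injective_iff, linearIndependent_iff_card_eq_finrank_span, Fintype.card_fin,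
      Set.finrank, ← rank_eq_finrank_span_cols, hX]
  have hM : (Xᵀ * R⁻¹ * X).PosDef := by
    have := hR.inv.conjTranspose_mul_mul_same (B := X) hXinj
    rwa [conjTranspose_eq_transpose_of_trivial] at this
  set M := Xᵀ * R⁻¹ * X with hMd
  set bh := (M⁻¹ * Xᵀ * R⁻¹) *ᵥ y with hbh
  set e := y - X *ᵥ bh with he
  set S := e ⬝ᵥ R⁻¹ *ᵥ e with hSd
  have hpos : ∀ β : Fin p → ℝ, 0 < (y - X *ᵥ β) ⬝ᵥ R⁻¹ *ᵥ (y - X *ᵥ β) := by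
    intro β
    have h := hR.inv.dotProduct_mulVec_pos (x := y - X *ᵥ β)
      (fun h => hy ⟨β, sub_eq_zero.mp h⟩)
    simpa using h
  have hS : 0 < S := hpos bh
  have hnormal : Xᵀ *ᵥ (R⁻¹ *ᵥ e) = 0 := by
    have : Xᵀ *ᵥ (R⁻¹ *ᵥ (X *ᵥ bh)) = Xᵀ *ᵥ (R⁻¹ *ᵥ y) := by
      rw [mulVec_mulVec, mulVec_mulVec, ← hMd, hbh, mulVec_mulVec,
        ← Matrix.mul_assoc, ← Matrix.mul_assoc,
        mul_nonsing_inv _ (isUnit_iff_ne_zero.mpr hM.det_pos.ne'), Matrix.one_mul, mulVec_mulVec]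
    rw [he, mulVec_sub, mulVec_sub, this, sub_self]
  have hRs : (R⁻¹)ᵀ = R⁻¹ := by
    have := hR.inv.isHermitian.eq
    rwa [conjTranspose_eq_transpose_of_trivial] at this
  have hquad : ∀ β : Fin p → ℝ, (y - X *ᵥ β) ⬝ᵥ R⁻¹ *ᵥ (y - X *ᵥ β) =
      S + (β - bh) ⬝ᵥ M *ᵥ (β - bh) := by
    intro β
    have e1 : y - X *ᵥ β = e - X *ᵥ (β - bh) := by rw [he, mulVec_sub]; abel
    have c1 : ∀ w, (X *ᵥ w) ⬝ᵥ R⁻¹ *ᵥ e = 0 := by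
      intro w
      rw [dotProduct_comm, dotProduct_mulVec, ← mulVec_transpose, hnormal, zero_dotProduct]
    have c2 : ∀ w, e ⬝ᵥ R⁻¹ *ᵥ (X *ᵥ w) = 0 := by
      intro w
      rw [dotProduct_mulVec, ← mulVec_transpose, hRs, dotProduct_comm, c1]
    have c3 : ∀ w, (X *ᵥ w) ⬝ᵥ R⁻¹ *ᵥ (X *ᵥ w) = w ⬝ᵥ M *ᵥ w := by
      intro w
      rw [hMd, ← mulVec_mulVec, ← mulVec_mulVec, dotProduct_mulVec w, vecMul_transpose]
    generalize β - bh = w at e1 ⊢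
    rw [e1, mulVec_sub, sub_dotProduct, dotProduct_sub, dotProduct_sub, c1, c2, c3]
    ring
  have hp0 : (0:ℝ) ≤ p := Nat.cast_nonneg p
  have hin := fun β : Fin p → ℝ =>
    inner_int n R hR (y - X *ᵥ β) ν a hν (by linarith) ha2 (hpos β)
  simp_rw [hin, hquad]
  rw [integral_const_mul,
    integral_sub_right_eq_self (fun z => (S + z ⬝ᵥ M *ᵥ z) ^ (-((n:ℝ) / 2 + a - 1))) bh,
    gauss_like p hp _ S (by linarith) hS M hM]
  rw [show (n:ℝ) / 2 + a - 1 - p / 2 = ((n : ℝ) - p) / 2 + a - 1 by ring]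
  have hG := Real.Gamma_pos_of_pos (show 0 < (n:ℝ) / 2 + a - 1 by linarith)
  have hG2 := Real.Gamma_pos_of_pos (show 0 < ν / 2 by positivity)
  have e5 : π ^ ((n:ℝ) / 2) = π ^ (((n : ℝ) - p) / 2) * π ^ ((p:ℝ) / 2) := by
    rw [← rpow_add pi_pos]; congr 1; ring
  rw [e5]
  have := rpow_pos_of_pos pi_pos (((n:ℝ) - p) / 2)
  have := rpow_pos_of_pos pi_pos ((p:ℝ) / 2)
  generalize Real.Gamma ((n:ℝ) / 2 + a - 1) = g at hG ⊢
  field_simp
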